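/- arXiv:1507.02630 — 2 statements merged into one kernel-verified Lean document; each statement's English description precedes it below -/
import Mathlib

section
/- For N ≥ 2, let σ be the uniform probability measure on the unit sphere S of ℂ^{N+1}. Then (1/2)·(N−1)·∑_{j=1}^{N} 1/j + ∫_{S^N} (1/2)·log(det G(v₁,…,v_N)) dσ^N(v₁,…,v_N) > 0, where G(v₁,…,v_N) is the Gram matrix of v₁,…,v_N. -/
open MeasureTheory

theorem Real.sub_sq_sub_le_log_one_add {u : ℝ} (hu : |u| ≤ 1 / 2) :
    u - u ^ 2 / 2 - 2 * |u| ^ 3 ≤ Real.log (1 + u) := by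
  have h := Real.abs_log_sub_add_sum_range_le (x := -u) (by rw [abs_neg]; linarith) 2
  simp only [Finset.sum_range_succ, Finset.sum_range_zero, abs_neg, sub_neg_eq_add] at h
  norm_num at h
  have h3 : |u| ^ 3 / (1 - |u|) ≤ 2 * |u| ^ 3 := by
    rw [div_le_iff₀ (by linarith)]
    nlinarith [pow_nonneg (abs_nonneg u) 3]
  have := (abs_le.1 h).1
  linarith

/-- A rotation by a small angle changes the squared modulus of a coordinate only slightly. -/
theorem abs_normSq_rotate_sub_le {z w : ℂ} {s c : ℝ} (hs : 0 ≤ s) (hs1 : s ≤ 1)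
    (hcs : c ^ 2 + s ^ 2 = 1) (hzw : ‖z‖ ^ 2 + ‖w‖ ^ 2 ≤ 1) :
    |‖(c : ℂ) * z + s * w‖ ^ 2 - ‖z‖ ^ 2| ≤ 2 * s := by
  have hc : |c| ≤ 1 := abs_le_one_iff_mul_self_le_one.2 (by nlinarith)
  rw [abs_le] at *
  simp only [← Complex.normSq_eq_norm_sq, Complex.normSq_apply, Complex.add_re, Complex.add_im,
    Complex.mul_re, Complex.mul_im, Complex.ofReal_re, Complex.ofReal_im] at *
  set R := z.re * w.re + z.im * w.im with hR
  have hR2 : |R| ≤ 1 / 2 := by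
    rw [abs_le]
    constructor <;> nlinarith [sq_nonneg (z.re - w.re), sq_nonneg (z.re + w.re),
      sq_nonneg (z.im - w.im), sq_nonneg (z.im + w.im)]
  have hcR : |c * R| ≤ 1 / 2 := by
    rw [abs_mul]
    nlinarith [abs_nonneg R, abs_nonneg c, abs_le.2 hc]
  rw [abs_le] at hcR
  have key : ((c * z.re - 0 * z.im + (s * w.re - 0 * w.im)) * (c * z.re - 0 * z.im + (s * w.re - 0 * w.im)) +
      (c * z.im + 0 * z.re + (s * w.im + 0 * w.re)) * (c * z.im + 0 * z.re + (s * w.im + 0 * w.re)) -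
      (z.re * z.re + z.im * z.im)) = s ^ 2 * ((w.re * w.re + w.im * w.im) - (z.re * z.re + z.im * z.im))
        + 2 * s * (c * R) := by
    rw [hR]
    linear_combination (z.re ^ 2 + z.im ^ 2) * hcs
  rw [key]
  have h1 : (w.re * w.re + w.im * w.im) - (z.re * z.re + z.im * z.im) ≤ 1 := by nlinarith
  have h2 : -1 ≤ (w.re * w.re + w.im * w.im) - (z.re * z.re + z.im * z.im) := by nlinarith
  have hss : s ^ 2 ≤ s := by nlinarith
  constructor <;> nlinarith [sq_nonneg s]

/-- Second-order lower bound for the variation of `log y` when `y` changes by the effect of a small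
rotation on `‖z‖ ^ 2`, summed over the four phases `1, I, -1, -I`. -/
theorem sum_log_rotate_lower_bound {z w : ℂ} {s c y ε : ℝ} (hε : 0 < ε) (hε1 : ε ≤ 1)
    (hy : ε ≤ y) (hs : 0 ≤ s) (hs1 : s ≤ ε / 4) (hcs : c ^ 2 + s ^ 2 = 1)
    (hzw : ‖z‖ ^ 2 + ‖w‖ ^ 2 ≤ 1) :
    4 * s ^ 2 * ((‖w‖ ^ 2 - ‖z‖ ^ 2) / y - ‖z‖ ^ 2 * ‖w‖ ^ 2 / y ^ 2) - 100 / ε ^ 3 * s ^ 3 ≤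
      ∑ n : Fin 4, (Real.log (y + (‖(c : ℂ) * z + s * (Complex.I ^ (n : ℕ) * w)‖ ^ 2 - ‖z‖ ^ 2))
        - Real.log y) := by
  have hy0 : 0 < y := hε.trans_le hy
  set d : Fin 4 → ℝ := fun n => ‖(c : ℂ) * z + s * (Complex.I ^ (n : ℕ) * w)‖ ^ 2 - ‖z‖ ^ 2 with hd
  have hdb : ∀ n, |d n| ≤ 2 * s := fun n =>
    abs_normSq_rotate_sub_le hs (by linarith) hcs (by simpa using hzw)
  have hub : ∀ n, |d n / y| ≤ 2 * s / ε := fun n => by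
    rw [abs_div, abs_of_pos hy0]
    exact div_le_div₀ (by positivity) (hdb n) hε hy
  have hterm : ∀ n, d n / y - (d n / y) ^ 2 / 2 - 16 / ε ^ 3 * s ^ 3 ≤
      Real.log (y + d n) - Real.log y := by
    intro n
    have hhalf : 2 * s / ε ≤ 1 / 2 := by rw [div_le_iff₀ hε]; linarith
    have h := Real.sub_sq_sub_le_log_one_add ((hub n).trans hhalf)
    have h3 : |d n / y| ^ 3 ≤ (2 * s / ε) ^ 3 := pow_le_pow_left₀ (abs_nonneg _) (hub n) 3
    have hpos : 0 < 1 + d n / y := by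
      have := (abs_le.1 ((hub n).trans hhalf)).1
      linarith
    have hlog : Real.log (y + d n) = Real.log y + Real.log (1 + d n / y) := by
      rw [← Real.log_mul hy0.ne' hpos.ne']
      congr 1
      field_simp
    have h4 : (2 * s / ε) ^ 3 = 8 / ε ^ 3 * s ^ 3 := by ring
    rw [hlog]
    rw [h4] at h3
    have h5 : 16 / ε ^ 3 * s ^ 3 = 2 * (8 / ε ^ 3 * s ^ 3) := by ring
    rw [h5]
    linarith
  set p := ‖z‖ ^ 2 with hp
  set q := ‖w‖ ^ 2 with hq
  have hp0 : 0 ≤ p := sq_nonneg _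
  have hq0 : 0 ≤ q := sq_nonneg _
  have hexp : d 0 + d 1 + d 2 + d 3 = 4 * s ^ 2 * (q - p) ∧
      d 0 ^ 2 + d 1 ^ 2 + d 2 ^ 2 + d 3 ^ 2 =
        4 * (s ^ 2 * (q - p)) ^ 2 + 8 * c ^ 2 * s ^ 2 * (p * q) := by
    have hd0 : d 0 = s ^ 2 * (q - p) + 2 * c * s * (z.re * w.re + z.im * w.im) := by
      simp [hd, hp, hq, ← Complex.normSq_eq_norm_sq, Complex.normSq_apply]
      linear_combination (z.re ^ 2 + z.im ^ 2) * hcs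
    have hd1 : d 1 = s ^ 2 * (q - p) + 2 * c * s * (z.im * w.re - z.re * w.im) := by
      simp [hd, hp, hq, ← Complex.normSq_eq_norm_sq, Complex.normSq_apply]
      linear_combination (z.re ^ 2 + z.im ^ 2) * hcs
    have hd2 : d 2 = s ^ 2 * (q - p) - 2 * c * s * (z.re * w.re + z.im * w.im) := by
      simp [hd, hp, hq, ← Complex.normSq_eq_norm_sq, Complex.normSq_apply]
      linear_combination (z.re ^ 2 + z.im ^ 2) * hcs
    have hd3 : d 3 = s ^ 2 * (q - p) - 2 * c * s * (z.im * w.re - z.re * w.im) := by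
      have h3 : d 3 = ‖(c : ℂ) * z + s * (-Complex.I * w)‖ ^ 2 - p := by
        rw [← Complex.I_pow_three]
        rfl
      rw [h3]
      simp only [hp, hq, ← Complex.normSq_eq_norm_sq, Complex.normSq_apply]
      simp
      linear_combination (z.re ^ 2 + z.im ^ 2) * hcs
    have hpq : p * q = (z.re * w.re + z.im * w.im) ^ 2 + (z.im * w.re - z.re * w.im) ^ 2 := by
      simp only [hp, hq, ← Complex.normSq_eq_norm_sq, Complex.normSq_apply]
      ring
    rw [hd0, hd1, hd2, hd3, hpq]
    constructor <;> ring
  have hsum : 4 * s ^ 2 * (q - p) / y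
      - (4 * (s ^ 2 * (q - p)) ^ 2 + 8 * c ^ 2 * s ^ 2 * (p * q)) / y ^ 2 / 2
      - 64 / ε ^ 3 * s ^ 3 ≤ ∑ n, (Real.log (y + d n) - Real.log y) := by
    rw [← hexp.1, ← hexp.2]
    refine le_trans (le_of_eq ?_) (Finset.sum_le_sum fun n _ => hterm n)
    simp only [Fin.sum_univ_four]
    ring
  refine le_trans ?_ hsum
  have hc1 : c ^ 2 ≤ 1 := by nlinarith
  have hA : (4 * (s ^ 2 * (q - p)) ^ 2 + 8 * c ^ 2 * s ^ 2 * (p * q)) / y ^ 2 / 2 ≤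
      4 * s ^ 2 * (p * q / y ^ 2) + 2 * s ^ 4 / ε ^ 2 := by
    have h1 : (q - p) ^ 2 ≤ 1 := by nlinarith
    have h2 : (4 * (s ^ 2 * (q - p)) ^ 2 + 8 * c ^ 2 * s ^ 2 * (p * q)) / y ^ 2 / 2 =
        4 * s ^ 2 * (p * q / y ^ 2) * c ^ 2 + 2 * s ^ 4 * (q - p) ^ 2 / y ^ 2 := by ring
    rw [h2]
    have h3 : 2 * s ^ 4 * (q - p) ^ 2 / y ^ 2 ≤ 2 * s ^ 4 / ε ^ 2 := by
      refine div_le_div₀ (by positivity) ?_ (by positivity) (by gcongr)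
      nlinarith [pow_nonneg hs 4]
    have h4 : 0 ≤ 4 * s ^ 2 * (p * q / y ^ 2) := by positivity
    nlinarith
  have hB : 2 * s ^ 4 / ε ^ 2 ≤ 36 / ε ^ 3 * s ^ 3 := by
    rw [div_mul_eq_mul_div, div_le_div_iff₀ (by positivity) (by positivity)]
    have : 0 ≤ s ^ 3 * ε ^ 2 := by positivity
    nlinarith [mul_nonneg this hε.le, mul_nonneg this hs]
  have hC : 4 * s ^ 2 * (q - p) / y = 4 * s ^ 2 * ((q - p) / y) := by ring
  have hD : 100 / ε ^ 3 * s ^ 3 = 64 / ε ^ 3 * s ^ 3 + 36 / ε ^ 3 * s ^ 3 := by ring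
  rw [hC, hD, mul_sub]
  linarith

section SphereAverage

variable {E : Type*} [NormedAddCommGroup E] [InnerProductSpace ℂ E]

/-- A reflection that acts on the `i`-th coordinate as a plane rotation mixing it with the `j`-th one,
and preserves the modulus of all coordinates other than these two. -/
theorem exists_isometry_sum_sq_inner_rotate {ι : Type*} [Fintype ι] [DecidableEq ι]
    (b : OrthonormalBasis ι ℂ E) {K : Finset ι} {i j : ι} (hi : i ∈ K) (hj : j ∉ K)
    {s c : ℝ} (hc : 0 ≤ c) (hcs : c ^ 2 + s ^ 2 = 1) {ω : ℂ} (hω : ‖ω‖ = 1) :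
    ∃ U : E ≃ₗᵢ[ℂ] E, ∀ x, ∑ k ∈ K, ‖inner ℂ (b k) (U x)‖ ^ 2 =
      ∑ k ∈ K, ‖inner ℂ (b k) x‖ ^ 2 +
        (‖(c : ℂ) * inner ℂ (b i) x + s * (ω * inner ℂ (b j) x)‖ ^ 2
          - ‖inner ℂ (b i) x‖ ^ 2) := by
  have hij : i ≠ j := fun h => hj (h ▸ hi)
  have hbi : ∀ k l, inner ℂ (b k) (b l) = if k = l then (1 : ℂ) else 0 :=
    orthonormal_iff_ite.1 b.orthonormal
  set t : ℝ := s / (1 + c) with ht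
  have ht1 : (1 + t ^ 2) * (1 + c) = 2 := by
    rw [ht]
    field_simp
    nlinarith
  have ht2 : t * (1 + c) = s := by
    rw [ht]
    field_simp
  set u : E := b i + (starRingEnd ℂ (t * ω)) • b j with hu
  have hux : ∀ x, inner ℂ u x = inner ℂ (b i) x + t * ω * inner ℂ (b j) x := by
    intro x
    rw [hu, inner_add_left, inner_smul_left, Complex.conj_conj]
  have hun : (‖u‖ : ℂ) ^ 2 = 1 + t ^ 2 := by
    have hself : (‖u‖ : ℂ) ^ 2 = inner ℂ u u := (inner_self_eq_norm_sq_to_K (𝕜 := ℂ) u).symm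
    rw [hself, hux, hu, inner_add_right, inner_add_right,
      inner_smul_right, inner_smul_right, hbi, hbi, hbi, hbi, if_pos rfl, if_neg hij,
      if_neg hij.symm, if_pos rfl]
    have h : ω * (starRingEnd ℂ) ω = 1 := by
      rw [Complex.mul_conj, Complex.normSq_eq_norm_sq, hω]
      simp
    rw [map_mul, Complex.conj_ofReal]
    linear_combination (t : ℂ) ^ 2 * h
  have ht1' : (1 + (t : ℂ) ^ 2) * (1 + c) = 2 := by exact_mod_cast ht1
  have ht2' : (t : ℂ) * (1 + c) = s := by exact_mod_cast ht2
  have hne : (1 + (t : ℂ) ^ 2) ≠ 0 := by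
    intro h
    rw [h, zero_mul] at ht1'
    norm_num at ht1'
  refine ⟨(ℂ ∙ u).reflection, fun x => ?_⟩
  have hk : ∀ k, inner ℂ (b k) ((ℂ ∙ u).reflection x) =
      (1 + c) * (inner ℂ (b i) x + t * ω * inner ℂ (b j) x) * inner ℂ (b k) u
        - inner ℂ (b k) x := by
    intro k
    rw [Submodule.reflection_singleton_apply, inner_sub_right, two_smul, inner_add_right,
      inner_smul_right, hux]
    have : (RCLike.ofReal ‖u‖ : ℂ) ^ 2 = 1 + t ^ 2 := hun
    rw [this]
    field_simp
    linear_combination (-(inner ℂ (b k) u) * (inner ℂ (b i) x + t * ω * inner ℂ (b j) x)) * ht1'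
  have hki : inner ℂ (b i) ((ℂ ∙ u).reflection x) =
      (c : ℂ) * inner ℂ (b i) x + s * (ω * inner ℂ (b j) x) := by
    rw [hk, hu, inner_add_right, inner_smul_right, hbi, hbi, if_pos rfl, if_neg hij]
    linear_combination (ω * inner ℂ (b j) x) * ht2'
  have hkk : ∀ k ∈ K.erase i, ‖inner ℂ (b k) ((ℂ ∙ u).reflection x)‖ ^ 2 =
      ‖inner ℂ (b k) x‖ ^ 2 := by
    intro k hkK
    have h1 : k ≠ i := Finset.ne_of_mem_erase hkK
    have h2 : k ≠ j := fun h => hj (h ▸ Finset.mem_of_mem_erase hkK)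
    rw [hk, hu, inner_add_right, inner_smul_right, hbi, hbi, if_neg h1, if_neg h2]
    simp
  rw [← Finset.add_sum_erase _ _ hi, ← Finset.add_sum_erase K (fun k => ‖inner ℂ (b k) x‖ ^ 2) hi,
    Finset.sum_congr rfl hkk, hki]
  ring

theorem ae_norm_eq_one {E : Type*} [NormedAddCommGroup E] [MeasurableSpace E] {σ : Measure E}
    (hsphere : σ (Metric.sphere (0 : E) 1)ᶜ = 0) : ∀ᵐ x ∂σ, ‖x‖ = 1 := by
  have : ∀ᵐ x ∂σ, x ∈ Metric.sphere (0 : E) 1 := hsphere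
  filter_upwards [this] with x hx
  simpa using hx

variable [FiniteDimensional ℂ E] [MeasurableSpace E] [BorelSpace E] {σ : Measure E}
  [IsProbabilityMeasure σ]

theorem Continuous.integrable_of_sphere (hsphere : σ (Metric.sphere (0 : E) 1)ᶜ = 0)
    {f : E → ℝ} (hf : Continuous f) : Integrable f σ := by
  have := FiniteDimensional.proper ℂ E
  have h : σ.restrict (Metric.sphere (0 : E) 1) = σ := Measure.restrict_eq_self_of_ae_mem hsphere
  rw [← h]
  exact hf.continuousOn.integrableOn_compact (isCompact_sphere _ _)

theorem integral_comp_isometry {E : Type*} [NormedAddCommGroup E] [InnerProductSpace ℂ E]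
    [MeasurableSpace E] [BorelSpace E] {σ : Measure E}
    (hinv : ∀ U : E ≃ₗᵢ[ℂ] E, σ.map U = σ) (U : E ≃ₗᵢ[ℂ] E) (f : E → ℝ) :
    ∫ x, f (U x) ∂σ = ∫ x, f x ∂σ :=
  MeasurePreserving.integral_comp (μ := σ) ⟨U.continuous.measurable, hinv U⟩
    U.toHomeomorph.measurableEmbedding f

/-- The second variation of `∫ log (∑ k ∈ K, |x_k|² + ε)` under rotations in the `(i, j)`-plane
has a sign, by invariance of `σ`. -/
theorem integral_log_variation_nonpos
    (hsphere : σ (Metric.sphere (0 : E) 1)ᶜ = 0) (hinv : ∀ U : E ≃ₗᵢ[ℂ] E, σ.map U = σ)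
    {ι : Type*} [Fintype ι] [DecidableEq ι]
    (b : OrthonormalBasis ι ℂ E) {K : Finset ι} {i j : ι} (hi : i ∈ K) (hj : j ∉ K)
    {ε : ℝ} (hε : 0 < ε) (hε1 : ε ≤ 1) :
    ∫ x, ((‖inner ℂ (b j) x‖ ^ 2 - ‖inner ℂ (b i) x‖ ^ 2)
          / (∑ k ∈ K, ‖inner ℂ (b k) x‖ ^ 2 + ε)
        - ‖inner ℂ (b i) x‖ ^ 2 * ‖inner ℂ (b j) x‖ ^ 2
          / (∑ k ∈ K, ‖inner ℂ (b k) x‖ ^ 2 + ε) ^ 2) ∂σ ≤ 0 := by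
  have hij : i ≠ j := fun h => hj (h ▸ hi)
  set S : E → ℝ := fun x => ∑ k ∈ K, ‖inner ℂ (b k) x‖ ^ 2 with hS
  have hS0 : ∀ x, 0 ≤ S x := fun x => Finset.sum_nonneg fun _ _ => sq_nonneg _
  have hSc : Continuous S := by fun_prop
  have hy : ∀ x, S x + ε ≠ 0 := fun x => by linarith [hS0 x]
  set Q : E → ℝ := fun x => (‖inner ℂ (b j) x‖ ^ 2 - ‖inner ℂ (b i) x‖ ^ 2) / (S x + ε)
        - ‖inner ℂ (b i) x‖ ^ 2 * ‖inner ℂ (b j) x‖ ^ 2 / (S x + ε) ^ 2 with hQ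
  have hQc : Continuous Q := by
    refine Continuous.sub (Continuous.div (by fun_prop) (by fun_prop) hy)
      (Continuous.div (by fun_prop) (by fun_prop) fun x => pow_ne_zero 2 (hy x))
  change ∫ x, Q x ∂σ ≤ 0
  have key : ∀ s : ℝ, 0 < s → s ≤ ε / 4 → 4 * s ^ 2 * ∫ x, Q x ∂σ ≤ 100 / ε ^ 3 * s ^ 3 := by
    intro s hs hs1
    set c : ℝ := √(1 - s ^ 2) with hc
    have hcs : c ^ 2 + s ^ 2 = 1 := by
      rw [hc, Real.sq_sqrt (by nlinarith)]
      ring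
    choose U hU using fun n : Fin 4 => exists_isometry_sum_sq_inner_rotate b hi hj
      (Real.sqrt_nonneg _) hcs (ω := Complex.I ^ (n : ℕ)) (by simp)
    have hlogc : Continuous fun x => Real.log (S x + ε) := (by fun_prop : Continuous fun x =>
      S x + ε).log hy
    have hint : ∀ n, Integrable (fun x => Real.log (S (U n x) + ε) - Real.log (S x + ε)) σ :=
      fun n => Continuous.integrable_of_sphere hsphere
        ((hlogc.comp (U n).continuous).sub hlogc)
    have hzero : ∫ x, ∑ n, (Real.log (S (U n x) + ε) - Real.log (S x + ε)) ∂σ = 0 := by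
      rw [integral_finsetSum _ fun n _ => hint n]
      refine Finset.sum_eq_zero fun n _ => ?_
      have hcomp : Integrable (fun x => Real.log (S (U n x) + ε)) σ :=
        Continuous.integrable_of_sphere hsphere (hlogc.comp (U n).continuous)
      rw [integral_sub hcomp (Continuous.integrable_of_sphere hsphere hlogc),
        integral_comp_isometry hinv (U n) (fun x => Real.log (S x + ε)), sub_self]
    have hle : ∫ x, (4 * s ^ 2 * Q x - 100 / ε ^ 3 * s ^ 3) ∂σ ≤
        ∫ x, ∑ n, (Real.log (S (U n x) + ε) - Real.log (S x + ε)) ∂σ := by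
      refine integral_mono_ae (Continuous.integrable_of_sphere hsphere (by fun_prop))
        (integrable_finsetSum _ fun n _ => hint n) ?_
      filter_upwards [ae_norm_eq_one hsphere] with x hx
      have hzw : ‖inner ℂ (b i) x‖ ^ 2 + ‖inner ℂ (b j) x‖ ^ 2 ≤ 1 := by
        have h := b.sum_sq_norm_inner_right x
        rw [hx, one_pow, ← Finset.add_sum_erase _ _ (Finset.mem_univ i),
          ← Finset.add_sum_erase _ _ (Finset.mem_erase.2 ⟨hij.symm, Finset.mem_univ j⟩)] at h
        have : 0 ≤ ∑ k ∈ (Finset.univ.erase i).erase j, ‖inner ℂ (b k) x‖ ^ 2 :=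
          Finset.sum_nonneg fun _ _ => sq_nonneg _
        linarith
      refine (sum_log_rotate_lower_bound (y := S x + ε) hε hε1 (by linarith [hS0 x]) hs.le hs1
        hcs hzw).trans_eq ?_
      refine Finset.sum_congr rfl fun n _ => ?_
      simp only [hS, hU n x]
      congr 2
      ring
    rw [hzero, integral_sub ((Continuous.integrable_of_sphere hsphere hQc).const_mul _)
      (integrable_const _), integral_const_mul] at hle
    simp at hle
    linarith
  by_contra! hpos
  set I := ∫ x, Q x ∂σ
  set s := min (ε / 4) (ε ^ 3 * I / 50) with hs
  have hs0 : 0 < s := lt_min (by positivity) (by positivity)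
  have h1 := key s hs0 (min_le_left _ _)
  have h2 : s ≤ ε ^ 3 * I / 50 := min_le_right _ _
  have h3 : 100 / ε ^ 3 * s ^ 3 ≤ 2 * s ^ 2 * I := by
    have : 100 / ε ^ 3 * s ^ 3 = s ^ 2 * (100 / ε ^ 3 * s) := by ring
    rw [this, mul_comm (2 : ℝ), mul_assoc]
    refine mul_le_mul_of_nonneg_left ?_ (sq_nonneg s)
    calc 100 / ε ^ 3 * s ≤ 100 / ε ^ 3 * (ε ^ 3 * I / 50) := by gcongr
      _ = 2 * I := by field_simp; norm_num
  have h4 : 0 < s ^ 2 * I := by positivity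
  linarith

theorem integral_one_div_sum_sq_inner_add_le
    (hsphere : σ (Metric.sphere (0 : E) 1)ᶜ = 0) (hinv : ∀ U : E ≃ₗᵢ[ℂ] E, σ.map U = σ)
    {ι : Type*} [Fintype ι] [DecidableEq ι]
    (b : OrthonormalBasis ι ℂ E) {K : Finset ι} (hK : K.card = 2) {ε : ℝ} (hε : 0 < ε)
    (hε1 : ε ≤ 1) :
    ∫ x, 1 / (∑ k ∈ K, ‖inner ℂ (b k) x‖ ^ 2 + ε) ∂σ ≤ (Fintype.card ι : ℝ) - 1 := by
  set S : E → ℝ := fun x => ∑ k ∈ K, ‖inner ℂ (b k) x‖ ^ 2 with hS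
  set n : ℝ := (Fintype.card ι : ℝ) with hn
  have hS0 : ∀ x, 0 ≤ S x := fun x => Finset.sum_nonneg fun _ _ => sq_nonneg _
  have hSc : Continuous S := by fun_prop
  have hy : ∀ x, S x + ε ≠ 0 := fun x => by linarith [hS0 x]
  set Q : ι → ι → E → ℝ := fun i j x =>
    (‖inner ℂ (b j) x‖ ^ 2 - ‖inner ℂ (b i) x‖ ^ 2) / (S x + ε)
        - ‖inner ℂ (b i) x‖ ^ 2 * ‖inner ℂ (b j) x‖ ^ 2 / (S x + ε) ^ 2 with hQ
  have hQi : ∀ i j, Integrable (Q i j) σ := fun i j =>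
    Continuous.integrable_of_sphere hsphere <|
      Continuous.sub (Continuous.div (by fun_prop) (by fun_prop) hy)
        (Continuous.div (by fun_prop) (by fun_prop) fun x => pow_ne_zero 2 (hy x))
  have hinvc : Continuous fun x => 1 / (S x + ε) :=
    Continuous.div (by fun_prop) (by fun_prop) hy
  have hneg : ∫ x, ∑ i ∈ K, ∑ j ∈ Kᶜ, Q i j x ∂σ ≤ 0 := by
    rw [integral_finsetSum _ fun i _ => integrable_finsetSum _ fun j _ => hQi i j]
    refine Finset.sum_nonpos fun i hi => ?_
    rw [integral_finsetSum _ fun j _ => hQi i j]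
    exact Finset.sum_nonpos fun j hj =>
      integral_log_variation_nonpos hsphere hinv b hi (Finset.mem_compl.1 hj) hε hε1
  have hle : ∫ x, ((1 + ε) * (1 / (S x + ε)) - (n - 1)) ∂σ ≤
      ∫ x, ∑ i ∈ K, ∑ j ∈ Kᶜ, Q i j x ∂σ := by
    refine integral_mono_ae (Continuous.integrable_of_sphere hsphere (by fun_prop))
      (integrable_finsetSum _ fun i _ => integrable_finsetSum _ fun j _ => hQi i j) ?_
    filter_upwards [ae_norm_eq_one hsphere] with x hx
    have hSx : S x + ∑ j ∈ Kᶜ, ‖inner ℂ (b j) x‖ ^ 2 = 1 := by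
      rw [hS, Finset.sum_add_sum_compl, b.sum_sq_norm_inner_right, hx, one_pow]
    have hT : ∑ j ∈ Kᶜ, ‖inner ℂ (b j) x‖ ^ 2 = 1 - S x := by linarith
    have hT0 : 0 ≤ 1 - S x := hT ▸ Finset.sum_nonneg fun _ _ => sq_nonneg _
    have hcard : ((Kᶜ.card : ℕ) : ℝ) = n - 2 := by
      rw [Finset.card_compl, Nat.cast_sub (Finset.card_le_univ K), hK]
      simp [hn]
    have hsum : ∑ i ∈ K, ∑ j ∈ Kᶜ, Q i j x =
        (2 * (1 - S x) - (n - 2) * S x) / (S x + ε) - S x * (1 - S x) / (S x + ε) ^ 2 := by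
      simp only [hQ, Finset.sum_sub_distrib, ← Finset.sum_div, ← Finset.mul_sum,
        ← Finset.sum_mul, hT, Finset.sum_const, hK, hcard, nsmul_eq_mul]
      rw [← hcard, Nat.cast_ofNat]
      change (2 * 1 - 2 * S x - (Kᶜ.card : ℝ) * S x) / (S x + ε)
        - S x * (1 - S x) / (S x + ε) ^ 2 = _
      rw [mul_sub 2]
    rw [hsum]
    have hn2 : 0 ≤ n - 2 := hcard ▸ Nat.cast_nonneg _
    have hy0 : 0 < S x + ε := by linarith [hS0 x]
    have h1 : S x / (S x + ε) ≤ 1 := (div_le_one hy0).2 (by linarith)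
    have h2 : S x * (1 - S x) / (S x + ε) ^ 2 ≤ (1 - S x) / (S x + ε) := by
      have : S x * (1 - S x) / (S x + ε) ^ 2 = S x / (S x + ε) * ((1 - S x) / (S x + ε)) := by
        field_simp
      rw [this]
      exact mul_le_of_le_one_left (div_nonneg hT0 hy0.le) h1
    have h3 : (2 * (1 - S x) - (n - 2) * S x) / (S x + ε) =
        2 * ((1 - S x) / (S x + ε)) - (n - 2) * (S x / (S x + ε)) := by ring
    have h4 : (1 + ε) * (1 / (S x + ε)) = (1 - S x) / (S x + ε) + 1 := by
      field_simp
      ring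
    rw [h3, h4]
    nlinarith
  rw [integral_sub ((Continuous.integrable_of_sphere hsphere hinvc).const_mul _)
    (integrable_const _), integral_const_mul] at hle
  simp only [integral_const, probReal_univ, one_smul] at hle
  have hpos : 0 ≤ ∫ x, 1 / (S x + ε) ∂σ :=
    integral_nonneg fun x => by have := hS0 x; positivity
  nlinarith

/-- The inverse squared norm of the projection of a uniform point of the sphere of `ℂⁿ` to a plane
has mean at most `n - 1`. -/
theorem lintegral_inv_sum_sq_inner_le
    (hsphere : σ (Metric.sphere (0 : E) 1)ᶜ = 0) (hinv : ∀ U : E ≃ₗᵢ[ℂ] E, σ.map U = σ)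
    {u : Fin 2 → E} (hu : Orthonormal ℂ u) :
    ∫⁻ x, (ENNReal.ofReal (∑ i, ‖inner ℂ (u i) x‖ ^ 2))⁻¹ ∂σ ≤
      ENNReal.ofReal ((Module.finrank ℂ E : ℝ) - 1) := by
  classical
  obtain ⟨w, b, hw, hb⟩ := hu.toSubtypeRange.exists_orthonormalBasis_extension
  set e : Fin 2 ↪ w := ⟨fun i => ⟨u i, hw ⟨i, rfl⟩⟩, fun i j hij =>
    hu.linearIndependent.injective (congrArg Subtype.val hij)⟩ with he
  set K : Finset w := Finset.univ.map e with hK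
  have hKcard : K.card = 2 := by simp [hK]
  have hsum : ∀ x, ∑ i, ‖inner ℂ (u i) x‖ ^ 2 = ∑ k ∈ K, ‖inner ℂ (b k) x‖ ^ 2 := by
    intro x
    rw [hK, Finset.sum_map]
    exact Finset.sum_congr rfl fun i _ => by rw [hb]; rfl
  set S : E → ℝ := fun x => ∑ k ∈ K, ‖inner ℂ (b k) x‖ ^ 2 with hS
  have hS0 : ∀ x, 0 ≤ S x := fun x => Finset.sum_nonneg fun _ _ => sq_nonneg _
  have hSc : Continuous S := by fun_prop
  set f : ℕ → E → ENNReal := fun n x => (ENNReal.ofReal (S x + 1 / ((n : ℝ) + 1)))⁻¹ with hf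
  have hlim : ∀ x, Filter.Tendsto (fun n => f n x) Filter.atTop
      (nhds (ENNReal.ofReal (∑ i, ‖inner ℂ (u i) x‖ ^ 2))⁻¹) := by
    intro x
    rw [hsum]
    refine (ENNReal.tendsto_ofReal ?_).inv
    simpa using (tendsto_const_nhds (x := S x)).add (tendsto_one_div_add_atTop_nhds_zero_nat (𝕜 := ℝ))
  have hbound : ∀ n, ∫⁻ x, f n x ∂σ ≤ ENNReal.ofReal ((Module.finrank ℂ E : ℝ) - 1) := by
    intro n
    have hε : (0 : ℝ) < 1 / ((n : ℝ) + 1) := by positivity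
    have hε1 : 1 / ((n : ℝ) + 1) ≤ 1 := by
      rw [div_le_one (by positivity)]
      linarith [Nat.cast_nonneg (α := ℝ) n]
    have hy : ∀ x, 0 < S x + 1 / ((n : ℝ) + 1) := fun x => by linarith [hS0 x]
    have hfe : ∀ x, f n x = ENNReal.ofReal (1 / (S x + 1 / ((n : ℝ) + 1))) := by
      intro x
      rw [hf, one_div (S x + _), ENNReal.ofReal_inv_of_pos (hy x)]
    simp only [hfe]
    have hfc : Continuous fun x => 1 / (S x + 1 / ((n : ℝ) + 1)) :=
      Continuous.div (by fun_prop) (by fun_prop) fun x => (hy x).ne'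
    rw [← ofReal_integral_eq_lintegral_ofReal (Continuous.integrable_of_sphere hsphere hfc)
      (Filter.Eventually.of_forall fun x => one_div_nonneg.2 (hy x).le)]
    refine ENNReal.ofReal_le_ofReal ?_
    rw [Module.finrank_eq_card_basis b.toBasis]
    exact integral_one_div_sum_sq_inner_add_le hsphere hinv b hKcard hε hε1
  calc ∫⁻ x, (ENNReal.ofReal (∑ i, ‖inner ℂ (u i) x‖ ^ 2))⁻¹ ∂σ
      = ∫⁻ x, Filter.liminf (fun n => f n x) Filter.atTop ∂σ :=
        lintegral_congr fun x => (hlim x).liminf_eq.symm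
    _ ≤ Filter.liminf (fun n => ∫⁻ x, f n x ∂σ) Filter.atTop :=
        lintegral_liminf_le fun n => by
          have : Continuous fun x => S x + 1 / ((n : ℝ) + 1) := by fun_prop
          exact (this.measurable.ennreal_ofReal).inv
    _ ≤ Filter.liminf (fun _ => ENNReal.ofReal ((Module.finrank ℂ E : ℝ) - 1)) Filter.atTop :=
        Filter.liminf_le_liminf (Filter.Eventually.of_forall hbound)
    _ = _ := Filter.liminf_const _

end SphereAverage

section GramDeterminant

variable {E : Type*} [NormedAddCommGroup E] [InnerProductSpace ℂ E]

theorem det_gram_updateRow_eq_zero_of_mem_span {k : ℕ} (w : E) (v : Fin k → E) {p : E}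
    (hp : p ∈ Submodule.span ℂ (Set.range v)) :
    ((Matrix.gram ℂ (Fin.cons w v : Fin (k + 1) → E)).updateRow 0
      (fun j => inner ℂ p ((Fin.cons w v : Fin (k + 1) → E) j))).det = 0 := by
  induction hp using Submodule.span_induction with
  | mem x hx =>
    obtain ⟨i, rfl⟩ := hx
    refine Matrix.det_zero_of_row_eq (i := 0) (j := i.succ) (Fin.succ_ne_zero i).symm ?_
    ext j
    simp [Matrix.updateRow_apply]
  | zero =>
    refine Matrix.det_eq_zero_of_row_eq_zero 0 fun j => ?_
    simp
  | add x y _ _ hx hy =>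
    simp only [inner_add_left]
    exact (Matrix.det_updateRow_add _ _ _ _).trans (by rw [hx, hy, add_zero])
  | smul a x _ hx =>
    simp only [inner_smul_left]
    exact (Matrix.det_updateRow_smul _ _ _ _).trans (by rw [hx, mul_zero])

/-- Adding to an orthogonal vector `q` an element of the span of `v` does not affect the
Gram determinant. -/
theorem det_gram_cons_add {k : ℕ} {p q : E} {v : Fin k → E}
    (hp : p ∈ Submodule.span ℂ (Set.range v)) (hq : ∀ i, inner ℂ q (v i) = 0) :
    (Matrix.gram ℂ (Fin.cons (p + q) v : Fin (k + 1) → E)).det =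
      (‖q‖ : ℂ) ^ 2 * (Matrix.gram ℂ v).det := by
  have hpq : inner ℂ q p = 0 := by
    have hle : Submodule.span ℂ (Set.range v) ≤ (ℂ ∙ q)ᗮ := by
      rw [Submodule.span_le]
      rintro _ ⟨i, rfl⟩
      exact Submodule.mem_orthogonal_singleton_iff_inner_right.2 (hq i)
    exact Submodule.mem_orthogonal_singleton_iff_inner_right.1 (hle hp)
  set x : Fin (k + 1) → E := Fin.cons (p + q) v with hx
  have h : Matrix.gram ℂ x = (Matrix.gram ℂ x).updateRow 0
      ((fun j => inner ℂ p (x j)) + fun j => inner ℂ q (x j)) := by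
    ext i j
    refine Fin.cases ?_ (fun i => ?_) i
    · simp [hx]
    · simp
  rw [h, Matrix.det_updateRow_add, det_gram_updateRow_eq_zero_of_mem_span _ _ hp, zero_add,
    Matrix.det_succ_row_zero, Fin.sum_univ_succ, Finset.sum_eq_zero]
  · have hsub : ((Matrix.gram ℂ x).updateRow 0 (fun j => inner ℂ q (x j))).submatrix
        Fin.succ (Fin.succAbove 0) = Matrix.gram ℂ v := by
      ext i j
      simp [hx]
    rw [hsub]
    simp [hx, hpq]
  · intro i _
    simp [hx, hq i]

theorem det_gram_re_nonneg {k : ℕ} (v : Fin k → E) : 0 ≤ (Matrix.gram ℂ v).det.re :=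
  (Complex.le_def.1 (Matrix.posSemidef_gram ℂ v).det_nonneg).1

theorem sum_sq_mul_det_gram_le_det_gram_cons [FiniteDimensional ℂ E] {k m : ℕ} (w : E)
    (v : Fin k → E) {u : Fin m → E} (hu : Orthonormal ℂ u)
    (huv : ∀ i j, inner ℂ (u i) (v j) = 0) :
    (∑ i, ‖inner ℂ (u i) w‖ ^ 2) * (Matrix.gram ℂ v).det.re ≤
      (Matrix.gram ℂ (Fin.cons w v : Fin (k + 1) → E)).det.re := by
  obtain ⟨p, hp, q, hq, rfl⟩ :=
    (Submodule.span ℂ (Set.range v)).exists_add_mem_mem_orthogonal w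
  have hqv : ∀ i, inner ℂ q (v i) = 0 := fun i =>
    (Submodule.mem_orthogonal' _ _).1 hq _ (Submodule.subset_span ⟨i, rfl⟩)
  have hup : ∀ i, inner ℂ (u i) p = 0 := by
    intro i
    have hle : Submodule.span ℂ (Set.range v) ≤ (ℂ ∙ u i)ᗮ := by
      rw [Submodule.span_le]
      rintro _ ⟨j, rfl⟩
      exact Submodule.mem_orthogonal_singleton_iff_inner_right.2 (huv i j)
    exact Submodule.mem_orthogonal_singleton_iff_inner_right.1 (hle hp)
  rw [det_gram_cons_add hp hqv]
  have hre : ((‖q‖ : ℂ) ^ 2 * (Matrix.gram ℂ v).det).re = ‖q‖ ^ 2 * (Matrix.gram ℂ v).det.re := by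
    rw [← Complex.ofReal_pow, Complex.re_ofReal_mul]
  rw [hre]
  refine mul_le_mul_of_nonneg_right ?_ (det_gram_re_nonneg v)
  simp only [inner_add_right, hup, zero_add]
  exact hu.sum_inner_products_le q

theorem exists_orthonormal_pair_orthogonal [FiniteDimensional ℂ E] {k : ℕ}
    (hk : k + 2 ≤ Module.finrank ℂ E) (v : Fin k → E) :
    ∃ u : Fin 2 → E, Orthonormal ℂ u ∧ ∀ i j, inner ℂ (u i) (v j) = 0 := by
  set W := Submodule.span ℂ (Set.range v)
  have h1 : Module.finrank ℂ W ≤ k := by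
    exact (finrank_range_le_card (R := ℂ) v).trans_eq (Fintype.card_fin k)
  have h2 := Submodule.finrank_add_finrank_orthogonal W
  have h3 : 2 ≤ Module.finrank ℂ Wᗮ := by omega
  refine ⟨fun i => (stdOrthonormalBasis ℂ Wᗮ (Fin.castLE h3 i) : E), ?_, fun i j => ?_⟩
  · have := (stdOrthonormalBasis ℂ Wᗮ).orthonormal.comp_linearIsometry Wᗮ.subtypeₗᵢ
    exact this.comp _ (Fin.castLE_injective h3)
  · exact (Submodule.mem_orthogonal' _ _).1 (stdOrthonormalBasis ℂ Wᗮ (Fin.castLE h3 i)).2 _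
      (Submodule.subset_span ⟨j, rfl⟩)

end GramDeterminant

section InverseDeterminant

variable {E : Type*} [NormedAddCommGroup E] [InnerProductSpace ℂ E] [FiniteDimensional ℂ E]
  [MeasurableSpace E] [BorelSpace E] {σ : Measure E} [IsProbabilityMeasure σ]

theorem continuous_det_gram_re {E : Type*} [NormedAddCommGroup E] [InnerProductSpace ℂ E] (k : ℕ) :
    Continuous fun v : Fin k → E => (Matrix.gram ℂ v).det.re := by
  refine Complex.continuous_re.comp (Continuous.matrix_det ?_)
  exact continuous_matrix fun i j => (continuous_apply i).inner (continuous_apply j)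

theorem measurable_inv_det_gram (k : ℕ) :
    Measurable fun v : Fin k → E => (ENNReal.ofReal (Matrix.gram ℂ v).det.re)⁻¹ := by
  have := FiniteDimensional.proper ℂ E
  exact (continuous_det_gram_re k).measurable.ennreal_ofReal.inv

/-- The mean of the inverse Gram determinant of `k + 1 < n` uniform points of the sphere of `ℂⁿ`
is at most `(n - 1) ^ k`. -/
theorem lintegral_inv_det_gram_le (hsphere : σ (Metric.sphere (0 : E) 1)ᶜ = 0)
    (hinv : ∀ U : E ≃ₗᵢ[ℂ] E, σ.map U = σ) (k : ℕ) (hk : k + 2 ≤ Module.finrank ℂ E) :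
    ∫⁻ v, (ENNReal.ofReal (Matrix.gram ℂ v).det.re)⁻¹ ∂(Measure.pi fun _ : Fin (k + 1) => σ) ≤
      ENNReal.ofReal ((Module.finrank ℂ E : ℝ) - 1) ^ k := by
  induction k with
  | zero =>
    have h : ∀ᵐ v ∂(Measure.pi fun _ : Fin 1 => σ),
        (ENNReal.ofReal (Matrix.gram ℂ v).det.re)⁻¹ = 1 := by
      filter_upwards [(Measure.tendsto_eval_ae_ae (i := (0 : Fin 1))).eventually
        (ae_norm_eq_one hsphere)] with v hv
      rw [Matrix.det_fin_one, Matrix.gram_apply, inner_self_eq_norm_sq_to_K]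
      simp only [Function.eval] at hv
      rw [hv]
      simp
    rw [lintegral_congr_ae h]
    simp
  | succ k ih =>
    have hp := (measurePreserving_piFinSuccAbove (fun _ : Fin (k + 2) => σ) 0).symm
    have hm := (measurable_inv_det_gram (E := E) (k + 2)).comp hp.measurable
    simp only [Function.comp_def] at hm
    rw [← hp.lintegral_comp (measurable_inv_det_gram (k + 2)),
      lintegral_prod_symm _ hm.aemeasurable]
    have hinner : ∀ v : Fin (k + 1) → E,
        ∫⁻ w, (ENNReal.ofReal (Matrix.gram ℂ (Fin.cons w v : Fin (k + 2) → E)).det.re)⁻¹ ∂σ ≤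
          ENNReal.ofReal ((Module.finrank ℂ E : ℝ) - 1) *
            (ENNReal.ofReal (Matrix.gram ℂ v).det.re)⁻¹ := by
      intro v
      obtain ⟨u, hu, huv⟩ := exists_orthonormal_pair_orthogonal (by omega) v
      have hmeas : Measurable fun w => (ENNReal.ofReal (∑ i, ‖inner ℂ (u i) w‖ ^ 2))⁻¹ := by
        have : Continuous fun w => ∑ i, ‖inner ℂ (u i) w‖ ^ 2 := by fun_prop
        exact this.measurable.ennreal_ofReal.inv
      have hpt : ∀ w, (ENNReal.ofReal
          (Matrix.gram ℂ (Fin.cons w v : Fin (k + 2) → E)).det.re)⁻¹ ≤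
          (ENNReal.ofReal (∑ i, ‖inner ℂ (u i) w‖ ^ 2))⁻¹ *
            (ENNReal.ofReal (Matrix.gram ℂ v).det.re)⁻¹ := by
        intro w
        rw [← ENNReal.mul_inv (Or.inr ENNReal.ofReal_ne_top) (Or.inl ENNReal.ofReal_ne_top),
          ENNReal.inv_le_inv, ← ENNReal.ofReal_mul (Finset.sum_nonneg fun _ _ => sq_nonneg _)]
        exact ENNReal.ofReal_le_ofReal (sum_sq_mul_det_gram_le_det_gram_cons w v hu huv)
      refine (lintegral_mono hpt).trans ?_
      rw [lintegral_mul_const _ hmeas]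
      gcongr
      exact lintegral_inv_sum_sq_inner_le hsphere hinv hu
    calc _ ≤ ∫⁻ v, ENNReal.ofReal ((Module.finrank ℂ E : ℝ) - 1) *
            (ENNReal.ofReal (Matrix.gram ℂ v).det.re)⁻¹ ∂(Measure.pi fun _ : Fin (k + 1) => σ) := by
          refine lintegral_mono fun v => ?_
          refine le_trans (le_of_eq ?_) (hinner v)
          refine lintegral_congr fun w => ?_
          simp [MeasurableEquiv.piFinSuccAbove, Fin.insertNthEquiv]
      _ ≤ _ := by
          rw [lintegral_const_mul _ (measurable_inv_det_gram (k + 1)), pow_succ']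
          gcongr
          exact ih (by omega)

end InverseDeterminant

/-- For `N ≥ 2` and `σ` the uniform probability measure on the unit sphere of
`ℂ^{N+1}`, the constant `(1/2)(N-1)∑_{j=1}^N 1/j` plus the integral over `S^N` of
`(1/2)·log det G(v₁,…,v_N)` is strictly positive. -/
theorem constant_positive (N : ℕ) (hN : 2 ≤ N)
    [MeasurableSpace (EuclideanSpace ℂ (Fin (N+1)))]
    [BorelSpace (EuclideanSpace ℂ (Fin (N+1)))]
    (σ : Measure (EuclideanSpace ℂ (Fin (N+1)))) [IsProbabilityMeasure σ]
    (hsphere : σ (Metric.sphere (0 : EuclideanSpace ℂ (Fin (N+1))) 1)ᶜ = 0)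
    (hinv : ∀ U : EuclideanSpace ℂ (Fin (N+1)) ≃ₗᵢ[ℂ] EuclideanSpace ℂ (Fin (N+1)),
      σ.map U = σ) :
    0 < (1/2 : ℝ) * ((N : ℝ) - 1) * (∑ j ∈ Finset.Icc 1 N, (1 : ℝ) / j)
        + ∫ v, (1/2 : ℝ) * Real.log
            ((Matrix.of fun a b : Fin N =>
              ∑ j, (v a) j * (starRingEnd ℂ) ((v b) j)).det.re)
            ∂(Measure.pi fun _ : Fin N => σ) := by
  set D : (Fin N → EuclideanSpace ℂ (Fin (N + 1))) → ℝ := fun v => (Matrix.gram ℂ v).det.re with hD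
  have hdet : ∀ v : Fin N → EuclideanSpace ℂ (Fin (N + 1)),
      (Matrix.of fun a b : Fin N => ∑ j, (v a) j * (starRingEnd ℂ) ((v b) j)).det.re = D v := by
    intro v
    rw [hD, ← Matrix.det_transpose]
    congr 2
  simp only [hdet]
  have hN2 : (2 : ℝ) ≤ N := by exact_mod_cast hN
  have hH : Real.log N < ∑ j ∈ Finset.Icc 1 N, (1 : ℝ) / j := by
    have h1 := log_add_one_le_harmonic N
    rw [harmonic_eq_sum_Icc] at h1
    push_cast at h1
    simp only [one_div]
    exact (Real.log_lt_log (by linarith) (by linarith)).trans_le h1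
  have hHpos : 0 < ((N : ℝ) - 1) * ∑ j ∈ Finset.Icc 1 N, (1 : ℝ) / j :=
    mul_pos (by linarith) ((Real.log_pos (by linarith)).trans hH)
  rw [integral_const_mul]
  by_cases hint : Integrable (fun v => Real.log (D v)) (Measure.pi fun _ : Fin N => σ)
  swap
  · rw [integral_undef hint]
    linarith
  set C : ℝ := (N : ℝ) ^ (N - 1) with hC
  have hCpos : 0 < C := by positivity
  have hlogC : Real.log C = ((N : ℝ) - 1) * Real.log N := by
    rw [hC, Real.log_pow, Nat.cast_sub (by omega), Nat.cast_one]
  have hlint : ∫⁻ v, (ENNReal.ofReal (D v))⁻¹ ∂(Measure.pi fun _ : Fin N => σ) ≤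
      ENNReal.ofReal C := by
    obtain ⟨k, rfl⟩ : ∃ k, N = k + 1 := ⟨N - 1, by omega⟩
    refine (lintegral_inv_det_gram_le hsphere hinv k (by simp)).trans_eq ?_
    rw [finrank_euclideanSpace_fin, hC, ENNReal.ofReal_pow (by positivity)]
    simp
  have hmeas : Measurable fun v => (ENNReal.ofReal (D v))⁻¹ := measurable_inv_det_gram N
  have hpos : ∀ᵐ v ∂(Measure.pi fun _ : Fin N => σ), 0 < D v := by
    filter_upwards [ae_lt_top hmeas (hlint.trans_lt ENNReal.ofReal_lt_top).ne] with v hv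
    simpa [ENNReal.inv_lt_top] using hv
  have hinv_eq : (fun v => ENNReal.ofReal (D v)⁻¹) =ᵐ[Measure.pi fun _ : Fin N => σ]
      fun v => (ENNReal.ofReal (D v))⁻¹ := by
    filter_upwards [hpos] with v hv
    exact ENNReal.ofReal_inv_of_pos hv
  have hDmeas : Measurable fun v => (D v)⁻¹ := by
    have := FiniteDimensional.proper ℂ (EuclideanSpace ℂ (Fin (N + 1)))
    exact (continuous_det_gram_re N).measurable.inv
  have hnonneg : ∀ v, 0 ≤ (D v)⁻¹ := fun v => inv_nonneg.2 (det_gram_re_nonneg v)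
  have hlint' : ∫⁻ v, ENNReal.ofReal (D v)⁻¹ ∂(Measure.pi fun _ : Fin N => σ) ≤
      ENNReal.ofReal C := (lintegral_congr_ae hinv_eq).trans_le hlint
  have hDint : Integrable (fun v => (D v)⁻¹) (Measure.pi fun _ : Fin N => σ) :=
    ⟨hDmeas.aestronglyMeasurable, by
      rw [hasFiniteIntegral_iff_ofReal (Filter.Eventually.of_forall hnonneg)]
      exact hlint'.trans_lt ENNReal.ofReal_lt_top⟩
  have hDle : ∫ v, (D v)⁻¹ ∂(Measure.pi fun _ : Fin N => σ) ≤ C := by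
    rw [← ENNReal.ofReal_le_ofReal_iff hCpos.le, ofReal_integral_eq_lintegral_ofReal hDint
      (Filter.Eventually.of_forall hnonneg)]
    exact hlint'
  have hlow : ∫ v, (1 - Real.log C - (D v)⁻¹ / C) ∂(Measure.pi fun _ : Fin N => σ) ≤
      ∫ v, Real.log (D v) ∂(Measure.pi fun _ : Fin N => σ) := by
    refine integral_mono_ae ((integrable_const _).sub (hDint.div_const C)) hint ?_
    filter_upwards [hpos] with v hv
    have h := Real.log_le_sub_one_of_pos (x := (D v)⁻¹ / C) (by positivity)
    rw [Real.log_div (by positivity) hCpos.ne', Real.log_inv] at h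
    linarith
  rw [integral_sub (integrable_const _) (hDint.div_const C), integral_div] at hlow
  simp only [integral_const, probReal_univ, one_smul] at hlow
  have h1 : (∫ v, (D v)⁻¹ ∂(Measure.pi fun _ : Fin N => σ)) / C ≤ 1 := (div_le_one hCpos).2 hDle
  have h2 : ((N : ℝ) - 1) * Real.log N < ((N : ℝ) - 1) * ∑ j ∈ Finset.Icc 1 N, (1 : ℝ) / j :=
    mul_lt_mul_of_pos_left hH (by linarith)
  linarith
end

section
/- For N ≥ 1, let σ be the uniform probability measure on the unit sphere S of ℂ^{N+1} and let σ^N be the product measure on S^N. Define F : (ℂ^{N+1})^N → ℂ^{N+1} by F(v₁,…,v_N)_i = (−1)^i · det(M_î), where M is the N×(N+1) matrix with rows v₁,…,v_N and M_î is M with its i-th column deleted. For σ^N-almost every (v₁,…,v_N) ∈ S^N the vectors v₁,…,v_N are linearly independent and hence F(v₁,…,v_N) ≠ 0. Then the pushforward of σ^N under the σ^N-almost-everywhere defined map (v₁,…,v_N) ↦ F(v₁,…,v_N)/‖F(v₁,…,v_N)‖ equals σ. -/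
open MeasureTheory

section Radial

variable {E : Type*} [NormedAddCommGroup E] [InnerProductSpace ℝ E]
  [MeasurableSpace E] [BorelSpace E]

/-- The characteristic function of a pushforward under a linear isometry. -/
lemma charFun_map_linearIsometryEquiv (μ : Measure E) (U : E ≃ₗᵢ[ℝ] E) (t : E) :
    charFun (μ.map U) (U t) = charFun μ t := by
  rw [charFun_apply, charFun_apply,
    integral_map U.continuous.measurable.aemeasurable
      (Continuous.aestronglyMeasurable (by fun_prop))]
  simp

/-- A measure is radial when its characteristic function only depends on the norm. -/
def IsRadial (μ : Measure E) : Prop :=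
  ∀ s t : E, ‖s‖ = ‖t‖ → charFun μ s = charFun μ t

lemma IsRadial.map_linearIsometryEquiv {μ : Measure E} (hμ : IsRadial μ) (U : E ≃ₗᵢ[ℝ] E) :
    IsRadial (μ.map U) := by
  intro s t hst
  rw [← U.apply_symm_apply s, ← U.apply_symm_apply t, charFun_map_linearIsometryEquiv,
    charFun_map_linearIsometryEquiv]
  exact hμ _ _ (by simpa using hst)

/-- A measure invariant under all real linear isometries is radial, since reflections act
transitively on spheres. -/
lemma IsRadial.of_map_eq {μ : Measure E} (hμ : ∀ U : E ≃ₗᵢ[ℝ] E, μ.map U = μ) :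
    IsRadial μ := by
  intro s t hst
  have h := charFun_map_linearIsometryEquiv μ (Submodule.reflection (ℝ ∙ (s - t))ᗮ) s
  rw [hμ, Submodule.reflection_sub hst] at h
  exact h.symm

variable [FiniteDimensional ℝ E]

/-- Averaging the characteristic function of one measure against the other shows that a radial
probability measure carried by the unit sphere is unique. -/
lemma IsRadial.eq_of_sphere {μ ν : Measure E} [IsProbabilityMeasure μ] [IsProbabilityMeasure ν]
    (hμ : IsRadial μ) (hν : IsRadial ν) (hμ1 : ∀ᵐ x ∂μ, ‖x‖ = 1) (hν1 : ∀ᵐ x ∂ν, ‖x‖ = 1) :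
    μ = ν := by
  refine Measure.ext_of_charFun (funext fun t => ?_)
  have average {μ ν : Measure E} [IsProbabilityMeasure μ] [IsProbabilityMeasure ν]
      (hμ : IsRadial μ) (hν1 : ∀ᵐ x ∂ν, ‖x‖ = 1) :
      ∫ y, charFun μ (‖t‖ • y) ∂ν = charFun μ t := by
    have h : (fun y => charFun μ (‖t‖ • y)) =ᵐ[ν] fun _ => charFun μ t := by
      filter_upwards [hν1] with y hy
      exact hμ _ _ (by simp [norm_smul, hy])
    rw [integral_congr_ae h]
    simp
  rw [← average hμ hν1, ← average hν hμ1]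
  simp only [charFun_apply]
  rw [integral_integral_swap]
  · refine integral_congr_ae (.of_forall fun x => integral_congr_ae (.of_forall fun y => ?_))
    simp only [inner_smul_right]
    rw [real_inner_comm]
  · refine Integrable.of_bound (C := 1)
      (Continuous.aestronglyMeasurable (by unfold Function.uncurry; fun_prop))
      (.of_forall fun p => ?_)
    simp only [Function.uncurry]
    rw [Complex.norm_exp_ofReal_mul_I]

/-- Normalizing the volume of the unit ball gives the radial probability measure on the sphere,
which does not charge proper subspaces. -/
lemma IsRadial.measure_submodule_eq_zero {μ : Measure E} [IsProbabilityMeasure μ]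
    (hμ : IsRadial μ) (hμ1 : ∀ᵐ x ∂μ, ‖x‖ = 1) (W : Submodule ℝ E) (hW : W ≠ ⊤) :
    μ W = 0 := by
  let _ : MeasureSpace E := measureSpaceOfInnerProductSpace
  have : Nontrivial E := by
    by_contra h
    rw [not_nontrivial_iff_subsingleton] at h
    exact hW (Subsingleton.elim _ _)
  set B : Set E := Metric.ball 0 1
  have hB0 : volume B ≠ 0 := (Metric.measure_ball_pos volume 0 one_pos).ne'
  set β : Measure E := ProbabilityTheory.cond volume B
  have : IsProbabilityMeasure β :=
    ProbabilityTheory.cond_isProbabilityMeasure_of_finite hB0 measure_ball_lt_top.ne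
  have hβ : β ≪ volume := ProbabilityTheory.cond_absolutelyContinuous
  have hβU (U : E ≃ₗᵢ[ℝ] E) : β.map U = β := by
    have h := U.measurePreserving.restrict_preimage (s := B) measurableSet_ball
    rw [show U ⁻¹' B = B by ext; simp [B]] at h
    rw [show β = (volume B)⁻¹ • volume.restrict B from rfl, Measure.map_smul, h.map_eq]
  have hmeas : Measurable fun x : E => ‖x‖⁻¹ • x := by fun_prop
  set ν : Measure E := β.map fun x => ‖x‖⁻¹ • x
  have : IsProbabilityMeasure ν := Measure.isProbabilityMeasure_map hmeas.aemeasurable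
  have hν : IsRadial ν := by
    refine .of_map_eq fun U => ?_
    rw [Measure.map_map U.continuous.measurable hmeas]
    conv_rhs => rw [show ν = β.map fun x => ‖x‖⁻¹ • x from rfl, ← hβU U,
      Measure.map_map hmeas U.continuous.measurable]
    congr 1
    ext x
    simp
  have hν1 : ∀ᵐ x ∂ν, ‖x‖ = 1 := by
    rw [ae_map_iff hmeas.aemeasurable (measurableSet_eq_fun (by fun_prop) (by fun_prop))]
    filter_upwards [hβ.ae_le (Measure.ae_ne volume (0 : E))] with x hx
    simp [norm_smul, hx]
  rw [hμ.eq_of_sphere hν hμ1 hν1,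
    Measure.map_apply hmeas W.closed_of_finiteDimensional.measurableSet]
  refine hβ (measure_mono_null (fun x hx => ?_) (Measure.addHaar_submodule volume W hW))
  by_cases hx0 : x = 0
  · simp [hx0]
  · simpa [W.smul_mem_iff, hx0] using hx

end Radial

section Wedge

variable {N : ℕ}

/-- The vector of signed maximal minors of the `N × (N + 1)` matrix with rows `v`. -/
noncomputable def minorVector (v : Fin N → EuclideanSpace ℂ (Fin (N + 1))) :
    EuclideanSpace ℂ (Fin (N + 1)) :=
  WithLp.toLp 2 fun i => (-1 : ℂ) ^ (i : ℕ) *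
    ((Matrix.of fun (a : Fin N) (j : Fin (N + 1)) => v a j).submatrix id i.succAbove).det

lemma continuous_minorVector : Continuous (minorVector (N := N)) := by
  refine (PiLp.continuous_toLp 2 _).comp (continuous_pi fun i => continuous_const.mul ?_)
  refine Continuous.matrix_det (continuous_matrix fun a j => ?_)
  simp only [Matrix.submatrix_apply, Matrix.of_apply]
  fun_prop

/-- Coordinatewise complex conjugation. -/
noncomputable def conjIsometry (N : ℕ) :
    EuclideanSpace ℂ (Fin (N + 1)) ≃ₗᵢ[ℝ] EuclideanSpace ℂ (Fin (N + 1)) :=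
  LinearIsometryEquiv.piLpCongrRight 2 fun _ => Complex.conjLIE

lemma conjIsometry_conjIsometry (x : EuclideanSpace ℂ (Fin (N + 1))) :
    conjIsometry N (conjIsometry N x) = x := by
  ext i
  simp [conjIsometry]

/-- Laplace expansion along the first row. -/
lemma inner_conjIsometry_minorVector (v : Fin N → EuclideanSpace ℂ (Fin (N + 1)))
    (w : EuclideanSpace ℂ (Fin (N + 1))) :
    inner ℂ (conjIsometry N (minorVector v)) w =
      (EuclideanSpace.basisFun (Fin (N + 1)) ℂ).toBasis.det
        (Fin.cons w v : Fin (N + 1) → EuclideanSpace ℂ (Fin (N + 1))) := by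
  rw [Module.Basis.det_apply, ← Matrix.det_transpose, Matrix.det_succ_row_zero, PiLp.inner_apply]
  refine Finset.sum_congr rfl fun i _ => ?_
  have h : (((EuclideanSpace.basisFun (Fin (N + 1)) ℂ).toBasis.toMatrix
      (Fin.cons w v : Fin (N + 1) → EuclideanSpace ℂ (Fin (N + 1)))).transpose.submatrix
        Fin.succ i.succAbove) =
      (Matrix.of fun (a : Fin N) (j : Fin (N + 1)) => v a j).submatrix id i.succAbove := by
    ext a j
    simp [Module.Basis.toMatrix_apply]
  rw [h]
  simp [conjIsometry, minorVector, Module.Basis.toMatrix_apply]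
  ring

lemma minorVector_smul (d : Fin N → ℂ) (v : Fin N → EuclideanSpace ℂ (Fin (N + 1))) :
    minorVector (fun i => d i • v i) = (∏ i, d i) • minorVector v := by
  ext i
  simp only [minorVector, PiLp.smul_apply, smul_eq_mul]
  rw [mul_left_comm, ← Matrix.det_mul_column]
  rfl

lemma conjIsometry_smul (c : ℂ) (x : EuclideanSpace ℂ (Fin (N + 1))) :
    conjIsometry N (c • x) = (starRingEnd ℂ c) • conjIsometry N x := by
  ext i
  simp [conjIsometry]

lemma conjIsometry_minorVector_map
    (U : EuclideanSpace ℂ (Fin (N + 1)) ≃ₗᵢ[ℂ] EuclideanSpace ℂ (Fin (N + 1)))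
    (v : Fin N → EuclideanSpace ℂ (Fin (N + 1))) :
    conjIsometry N (minorVector fun i => U (v i)) =
      starRingEnd ℂ (LinearMap.det U.toLinearEquiv.toLinearMap) •
        U (conjIsometry N (minorVector v)) := by
  refine ext_inner_right ℂ fun w => ?_
  obtain ⟨w, rfl⟩ := U.surjective w
  rw [inner_smul_left, U.inner_map_map, inner_conjIsometry_minorVector,
    inner_conjIsometry_minorVector, Complex.conj_conj, ← Module.Basis.det_comp]
  congr 1
  ext i : 1
  refine Fin.cases ?_ (fun i => ?_) i <;> simp

lemma minorVector_ne_zero {v : Fin N → EuclideanSpace ℂ (Fin (N + 1))}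
    (hv : LinearIndependent ℂ v) : minorVector v ≠ 0 := by
  intro h0
  obtain ⟨w, hw⟩ : ∃ w, w ∉ Submodule.span ℂ (Set.range v) := by
    by_contra! h
    have h1 := finrank_range_le_card (R := ℂ) v
    rw [Set.finrank, Submodule.eq_top_iff'.2 h, finrank_top] at h1
    simp at h1
  have hdet := (EuclideanSpace.basisFun (Fin (N + 1)) ℂ).toBasis.isUnit_det
    (basisOfLinearIndependentOfCardEqFinrank (linearIndependent_finCons.2 ⟨hv, hw⟩) (by simp))
  rw [coe_basisOfLinearIndependentOfCardEqFinrank, ← inner_conjIsometry_minorVector, h0] at hdet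
  simp at hdet

section Measure

variable [MeasurableSpace (EuclideanSpace ℂ (Fin (N + 1)))]
  [BorelSpace (EuclideanSpace ℂ (Fin (N + 1)))]

/-- The unitary group acts transitively on spheres. -/
lemma IsRadial.of_map_unitary {μ : Measure (EuclideanSpace ℂ (Fin (N + 1)))}
    (hμ : ∀ U : EuclideanSpace ℂ (Fin (N + 1)) ≃ₗᵢ[ℂ] EuclideanSpace ℂ (Fin (N + 1)),
      μ.map U = μ) : IsRadial μ := by
  intro s t hst
  obtain ⟨U, rfl⟩ : ∃ U : EuclideanSpace ℂ (Fin (N + 1)) ≃ₗᵢ[ℂ] EuclideanSpace ℂ (Fin (N + 1)),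
      U s = t := by
    by_cases hs : s = 0
    · exact ⟨.refl ℂ _, by rw [hs, norm_zero] at hst; simp [hs, norm_eq_zero.1 hst.symm]⟩
    have ht : t ≠ 0 := by
      rintro rfl
      simp_all
    have extend (x : EuclideanSpace ℂ (Fin (N + 1))) (hx : x ≠ 0) :
        ∃ b : OrthonormalBasis (Fin (N + 1)) ℂ (EuclideanSpace ℂ (Fin (N + 1))),
          b 0 = (‖x‖⁻¹ : ℂ) • x := by
      obtain ⟨b, hb⟩ := Orthonormal.exists_orthonormalBasis_extension_of_card_eq (𝕜 := ℂ)
        (v := fun _ : Fin (N + 1) => (‖x‖⁻¹ : ℂ) • x) (s := {0}) (by simp)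
        (by
          refine ⟨fun i => by simp [norm_smul, hx], fun i j hij => ?_⟩
          exact (hij (Subsingleton.elim i j)).elim)
      exact ⟨b, hb 0 rfl⟩
    obtain ⟨b, hb⟩ := extend s hs
    obtain ⟨c, hc⟩ := extend t ht
    refine ⟨b.equiv c (Equiv.refl _), ?_⟩
    have h : b.equiv c (Equiv.refl _) (b 0) = c 0 := by simp
    rw [hb, hc, map_smul, hst] at h
    exact smul_right_injective _ (by simpa using ht) h
  let V : EuclideanSpace ℂ (Fin (N + 1)) ≃ₗᵢ[ℝ] EuclideanSpace ℂ (Fin (N + 1)) :=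
    { U.toLinearEquiv.restrictScalars ℝ with norm_map' := U.norm_map }
  have h := charFun_map_linearIsometryEquiv μ V s
  rw [show μ.map V = μ from hμ U] at h
  exact h.symm

lemma ae_linearIndependent_pi (σ : Measure (EuclideanSpace ℂ (Fin (N + 1))))
    [IsProbabilityMeasure σ]
    (hσ : ∀ W : Submodule ℂ (EuclideanSpace ℂ (Fin (N + 1))), W ≠ ⊤ → σ W = 0)
    (k : ℕ) (hk : k ≤ N + 1) :
    ∀ᵐ v ∂(Measure.pi fun _ : Fin k => σ), LinearIndependent ℂ v := by
  induction k with
  | zero => exact .of_forall fun v => linearIndependent_empty_type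
  | succ k ih =>
    have hmp := (measurePreserving_piFinSuccAbove (fun _ : Fin (k + 1) => σ) 0).symm
    have hopen : MeasurableSet {v : Fin (k + 1) → EuclideanSpace ℂ (Fin (N + 1)) |
        LinearIndependent ℂ v} := isOpen_setOfPred_linearIndependent.measurableSet
    rw [← hmp.map_eq, ae_map_iff hmp.measurable.aemeasurable hopen]
    have hpre : MeasurableSet {x : EuclideanSpace ℂ (Fin (N + 1)) ×
        (Fin k → EuclideanSpace ℂ (Fin (N + 1))) | LinearIndependent ℂ
          ((MeasurableEquiv.piFinSuccAbove
            (fun _ => EuclideanSpace ℂ (Fin (N + 1))) 0).symm (x.1, x.2))} :=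
      hmp.measurable hopen
    rw [Measure.ae_prod_iff_ae_ae hpre, Measure.ae_ae_comm hpre]
    filter_upwards [ih (by omega)] with v hv
    have hspan : Submodule.span ℂ (Set.range v) ≠ ⊤ := by
      intro h
      have h1 := finrank_range_le_card (R := ℂ) v
      rw [Set.finrank, h, finrank_top] at h1
      simp at h1
      omega
    filter_upwards [measure_eq_zero_iff_ae_notMem.1 (hσ _ hspan)] with x hx
    have h := linearIndependent_finCons.2 ⟨hv, hx⟩
    simpa [MeasurableEquiv.piFinSuccAbove, Fin.insertNthEquiv] using h

end Measure

end Wedge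

/-- Let `σ` be the uniform probability measure on the unit sphere `S` of `ℂ^{N+1}`
and let `F(v₁,…,v_N)_i = (-1)^i det(M_î)` where `M` has rows `v₁,…,v_N` and `M_î`
is `M` with its `i`-th column deleted. For `σ^N`-almost every tuple the vectors
are linearly independent (so `F ≠ 0`), and the pushforward of `σ^N` under
`v ↦ F(v)/‖F(v)‖` equals `σ`. -/
theorem pushforward_wedge_uniform (N : ℕ) (hN : 1 ≤ N)
    [MeasurableSpace (EuclideanSpace ℂ (Fin (N+1)))]
    [BorelSpace (EuclideanSpace ℂ (Fin (N+1)))]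
    (σ : Measure (EuclideanSpace ℂ (Fin (N+1)))) [IsProbabilityMeasure σ]
    (hsphere : σ (Metric.sphere (0 : EuclideanSpace ℂ (Fin (N+1))) 1)ᶜ = 0)
    (hinv : ∀ U : EuclideanSpace ℂ (Fin (N+1)) ≃ₗᵢ[ℂ] EuclideanSpace ℂ (Fin (N+1)),
      σ.map U = σ)
    (F : (Fin N → EuclideanSpace ℂ (Fin (N+1))) → EuclideanSpace ℂ (Fin (N+1)))
    (hF : ∀ v (i : Fin (N+1)), F v i
      = (-1 : ℂ) ^ (i : ℕ)
        * ((Matrix.of fun (a : Fin N) (j : Fin (N+1)) => v a j).submatrix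
            id i.succAbove).det) :
    (∀ᵐ v ∂(Measure.pi fun _ : Fin N => σ), LinearIndependent ℂ v ∧ F v ≠ 0) ∧
    Measure.map (fun v => ‖F v‖⁻¹ • F v) (Measure.pi fun _ : Fin N => σ) = σ := by
  obtain rfl : F = minorVector := by
    ext v i
    rw [hF]
    rfl
  have hσ := IsRadial.of_map_unitary hinv
  have hσ1 : ∀ᵐ x ∂σ, ‖x‖ = 1 := by
    filter_upwards [measure_eq_zero_iff_ae_notMem.1 hsphere] with x hx
    simpa using hx
  have hindep := ae_linearIndependent_pi σ
    (fun W hW => hσ.measure_submodule_eq_zero hσ1 (W.restrictScalars ℝ) (by simpa using hW))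
    N (Nat.le_succ N)
  refine ⟨hindep.mono fun v hv => ⟨hv, minorVector_ne_zero hv⟩, ?_⟩
  set P := Measure.pi fun _ : Fin N => σ
  set J := conjIsometry N
  have hJ : Measurable J := J.continuous.measurable
  have hmeas : Measurable fun v : Fin N → EuclideanSpace ℂ (Fin (N + 1)) =>
      ‖minorVector v‖⁻¹ • minorVector v := by
    have := (continuous_minorVector (N := N)).measurable
    fun_prop
  set ν := P.map fun v => ‖minorVector v‖⁻¹ • minorVector v
  have : IsProbabilityMeasure ν := Measure.isProbabilityMeasure_map hmeas.aemeasurable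
  have hν1 : ∀ᵐ x ∂ν, ‖x‖ = 1 := by
    rw [ae_map_iff hmeas.aemeasurable (measurableSet_eq_fun (by fun_prop) (by fun_prop))]
    filter_upwards [hindep] with v hv
    simp [norm_smul, minorVector_ne_zero hv]
  have hJν : IsRadial (ν.map J) := by
    refine .of_map_unitary fun U => ?_
    set c := LinearMap.det U.toLinearEquiv.toLinearMap
    have hc : ‖c‖ = 1 := by
      rw [← LinearMap.normDet_eq_norm_det]
      exact U.toLinearIsometry.normDet_eq_one
    have hc0 : c ≠ 0 := by
      rintro h
      simp [h] at hc
    let d : Fin N → ℂ := fun i => if (i : ℕ) = 0 then c⁻¹ else 1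
    have hprod : ∏ i, d i = c⁻¹ := by
      obtain ⟨n, rfl⟩ : ∃ n, N = n + 1 := ⟨N - 1, by omega⟩
      simp [d]
    have hd (i : Fin N) : ‖d i‖ = 1 := by
      by_cases hi : (i : ℕ) = 0 <;> simp [d, hi, hc]
    have hT : MeasurePreserving (fun (v : Fin N → EuclideanSpace ℂ (Fin (N + 1))) i =>
        d i • U (v i)) P P := by
      refine measurePreserving_pi (fun _ : Fin N => σ) (fun _ : Fin N => σ)
        (f := fun i x => d i • U x) fun i => ?_
      let V := U.trans ({ LinearEquiv.smulOfNeZero ℂ (EuclideanSpace ℂ (Fin (N + 1))) (d i)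
        (by rw [← norm_ne_zero_iff, hd]; exact one_ne_zero) with
          norm_map' := fun x => by
            change ‖d i • x‖ = ‖x‖
            rw [norm_smul, hd, one_mul] } : _ ≃ₗᵢ[ℂ] _)
      exact ⟨V.continuous.measurable, hinv V⟩
    have hequiv (v : Fin N → EuclideanSpace ℂ (Fin (N + 1))) :
        J (minorVector fun i => d i • U (v i)) = U (J (minorVector v)) := by
      rw [minorVector_smul, hprod, conjIsometry_smul, conjIsometry_minorVector_map, smul_smul,
        ← map_mul, inv_mul_cancel₀ hc0, map_one, one_smul]
    have hnorm (v : Fin N → EuclideanSpace ℂ (Fin (N + 1))) :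
        ‖minorVector fun i => d i • U (v i)‖ = ‖minorVector v‖ := by
      rw [← J.norm_map, hequiv, U.norm_map, J.norm_map]
    have hU : Measurable U := U.continuous.measurable
    rw [Measure.map_map hU hJ, Measure.map_map (hU.comp hJ) hmeas]
    conv_rhs => rw [show ν = P.map fun v => ‖minorVector v‖⁻¹ • minorVector v from rfl,
      Measure.map_map hJ hmeas, ← hT.map_eq, Measure.map_map (hJ.comp hmeas) hT.measurable]
    congr 1
    ext v : 1
    simp only [Function.comp_apply]
    rw [hnorm, map_smul J, map_smul J, hequiv, map_real_smul U U.continuous]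
  have hν : IsRadial ν := by
    have h := hJν.map_linearIsometryEquiv J
    rwa [Measure.map_map hJ hJ, show J ∘ J = id from funext conjIsometry_conjIsometry,
      Measure.map_id] at h
  exact hν.eq_of_sphere hσ hν1 hσ1
end
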